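/- arXiv:1610.07087 — 2 statements merged into one kernel-verified Lean document; each statement's English description precedes it below -/
import Mathlib

section
/- Let A be an algebra with Day operations m₀,…,m_n, let k ≥ 2, let θ₀,…,θ_{k-2} ∈ Con(A), and let (γᵢ)_{i∈I} be a nonempty family of congruences of A. Then [θ₀,…,θ_{k-2}, ⋁_{i∈I} γᵢ] = ⋁_{i∈I} [θ₀,…,θ_{k-2}, γᵢ] (additivity of the higher commutator in its last argument). -/
namespace UACommutator

/-- A signature: a type of operation symbols with arities. -/
structure Signature where
  ops : Type
  arity : ops → ℕ

/-- An algebra for a signature: a nonempty carrier with interpretations of the operations. -/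
structure Alg (σ : Signature) where
  carrier : Type
  nonempty : Nonempty carrier
  interp : (o : σ.ops) → (Fin (σ.arity o) → carrier) → carrier

/-- A congruence of an algebra: an equivalence relation compatible with all basic operations. -/
structure Congruence {σ : Signature} (A : Alg σ) where
  rel : A.carrier → A.carrier → Prop
  iseqv : Equivalence rel
  compat : ∀ (o : σ.ops) (x y : Fin (σ.arity o) → A.carrier),
    (∀ i, rel (x i) (y i)) → rel (A.interp o x) (A.interp o y)

instance {σ : Signature} {A : Alg σ} : LE (Congruence A) :=
  ⟨fun a b => ∀ x y, a.rel x y → b.rel x y⟩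

/-- Terms of the signature with variables in `V`. -/
inductive Term (σ : Signature) (V : Type) : Type
  | var : V → Term σ V
  | app : (o : σ.ops) → (Fin (σ.arity o) → Term σ V) → Term σ V

def Term.evalA {σ : Signature} (A : Alg σ) {V : Type} :
    Term σ V → (V → A.carrier) → A.carrier
  | .var v, env => env v
  | .app o args, env => A.interp o (fun i => (args i).evalA A env)

/-- Polynomial operations of an algebra `A` with variables in `V`:
built from variables, constants of `A`, and the basic operations. -/
inductive Poly {σ : Signature} (A : Alg σ) (V : Type) : Type
  | var : V → Poly A V
  | const : A.carrier → Poly A V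
  | app : (o : σ.ops) → (Fin (σ.arity o) → Poly A V) → Poly A V

def Poly.eval {σ : Signature} {A : Alg σ} {V : Type} :
    Poly A V → (V → A.carrier) → A.carrier
  | .var v, env => env v
  | .const c, _ => c
  | .app o args, env => A.interp o (fun i => (args i).eval env)

/-- Evaluate a polynomial whose variables are grouped into `k` tuples (tuple `i` of
length `ν i`) at the tuples `a i` (where `g i = false`) or `b i` (where `g i = true`). -/
def evalTup {σ : Signature} {A : Alg σ} {k : ℕ} {ν : Fin k → ℕ}
    (p : Poly A (Σ i, Fin (ν i))) (a b : ∀ i, Fin (ν i) → A.carrier)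
    (g : Fin k → Bool) : A.carrier :=
  p.eval (fun x => if g x.1 then b x.1 x.2 else a x.1 x.2)

/-- The term condition `C(α₀,…,α_{k-1}; δ)`, centralizing at coordinate `j`. -/
def TC {σ : Signature} {A : Alg σ} {k : ℕ} (α : Fin k → Congruence A) (j : Fin k)
    (δ : Congruence A) : Prop :=
  ∀ (ν : Fin k → ℕ) (p : Poly A (Σ i, Fin (ν i)))
    (a b : ∀ i, Fin (ν i) → A.carrier),
    (∀ i mm, (α i).rel (a i mm) (b i mm)) →
    (∀ g : Fin k → Bool, g j = false → (∃ i, i ≠ j ∧ g i = false) →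
      δ.rel (evalTup p a b g) (evalTup p a b (Function.update g j true))) →
    δ.rel (evalTup p a b (Function.update (fun _ => true) j false))
          (evalTup p a b (fun _ => true))

/-- The meet (intersection) of a family of congruences. -/
def infCong {σ : Signature} {A : Alg σ} {ι : Sort*} (ds : ι → Congruence A) :
    Congruence A where
  rel x y := ∀ i, (ds i).rel x y
  iseqv := ⟨fun x i => (ds i).iseqv.refl x,
            fun h i => (ds i).iseqv.symm (h i),
            fun h h' i => (ds i).iseqv.trans (h i) (h' i)⟩
  compat o x y h := fun i => (ds i).compat o x y (fun mm => h mm i)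

/-- The higher commutator `[α₀,…,α_{k-1}]` (term-condition version), as the meet of
all congruences `δ` such that `C(α₀,…,α_{k-1}; δ)` holds, centralizing at `j`. -/
def commTC {σ : Signature} {A : Alg σ} {k : ℕ} (α : Fin k → Congruence A) (j : Fin k) :
    Congruence A :=
  infCong (fun d : {δ : Congruence A // TC α j δ} => d.val)

/-- The congruence generated by a binary relation `X`. -/
def Cg {σ : Signature} {A : Alg σ} (X : A.carrier → A.carrier → Prop) : Congruence A :=
  infCong (fun d : {δ : Congruence A // ∀ x y, X x y → δ.rel x y} => d.val)

theorem Cg_base {σ : Signature} {A : Alg σ} (X : A.carrier → A.carrier → Prop)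
    {x y : A.carrier} (h : X x y) : (Cg X).rel x y :=
  fun i => i.2 x y h

/-- The join of a family of congruences: the least congruence containing every member. -/
def supCong {σ : Signature} {A : Alg σ} {ι : Sort*} (γ : ι → Congruence A) :
    Congruence A :=
  Cg (fun x y => ∃ i, (γ i).rel x y)

/-- The join of two congruences. -/
def joinCong {σ : Signature} {A : Alg σ} (a b : Congruence A) : Congruence A :=
  Cg (fun x y => a.rel x y ∨ b.rel x y)

/-- `m` is a `T`-matrix for `T = (θ₀,…,θ_{k-1})`. -/
def IsMatrix {σ : Signature} {A : Alg σ} {k : ℕ} (θ : Fin k → Congruence A)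
    (m : (Fin k → Bool) → A.carrier) : Prop :=
  ∃ (ν : Fin k → ℕ) (p : Poly A (Σ i, Fin (ν i))) (a b : ∀ i, Fin (ν i) → A.carrier),
    (∀ i jj, (θ i).rel (a i jj) (b i jj)) ∧
    ∀ f : Fin k → Bool, m f = evalTup p a b f

/-- The matrix centralization condition `C(T; j; δ)`: for every `T`-matrix, if every
`(j)`-supporting line is a `δ`-pair then the `(j)`-pivot line is a `δ`-pair. -/
def CMat {σ : Signature} {A : Alg σ} {k : ℕ} (θ : Fin k → Congruence A) (j : Fin k)
    (δ : Congruence A) : Prop :=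
  ∀ m : (Fin k → Bool) → A.carrier, IsMatrix θ m →
    (∀ g : Fin k → Bool, (∃ i, i ≠ j ∧ g i = false) →
      δ.rel (m (Function.update g j false)) (m (Function.update g j true))) →
    δ.rel (m (Function.update (fun _ => true) j false)) (m (fun _ => true))

/-- `[T]_j`: the meet of all congruences `δ` with `C(T; j; δ)`. -/
def commMat {σ : Signature} {A : Alg σ} {k : ℕ} (θ : Fin k → Congruence A) (j : Fin k) :
    Congruence A :=
  infCong (fun d : {δ : Congruence A // CMat θ j δ} => d.val)

/-- Day operations `m₀, …, m_n` for an algebra, each induced by a term of the signature. -/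
structure DayOps {σ : Signature} (A : Alg σ) (n : ℕ) where
  m : Fin (n+1) → A.carrier → A.carrier → A.carrier → A.carrier → A.carrier
  isTerm : ∀ e, ∃ t : Term σ (Fin 4), ∀ x y z u, m e x y z u = t.evalA A ![x, y, z, u]
  idem : ∀ e x y, m e x y y x = x
  first : ∀ x y z u, m 0 x y z u = x
  last : ∀ x y z u, m (Fin.last n) x y z u = u
  even : ∀ (e : ℕ) (he : e < n), Even e → ∀ x u,
    m ⟨e, by omega⟩ x x u u = m ⟨e+1, by omega⟩ x x u u
  odd : ∀ (e : ℕ) (he : e < n), Odd e → ∀ x y u,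
    m ⟨e, by omega⟩ x y y u = m ⟨e+1, by omega⟩ x y y u

/-- The `e`-th shift rotation at `(j, l)` of a cube `h`. -/
def shiftRot {σ : Signature} {A : Alg σ} {n k : ℕ} (D : DayOps A n) (e : Fin (n+1))
    (j l : Fin k) (h : (Fin k → Bool) → A.carrier) :
    (Fin k → Bool) → A.carrier := fun f =>
  let r := h (Function.update (Function.update f j false) l false)
  let s := h (Function.update (Function.update f j false) l true)
  let u := h (Function.update (Function.update f j true) l false)
  let v := h (Function.update (Function.update f j true) l true)
  if f j then (if f l then D.m e s s v v else D.m e s r u v) else s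

/-- `hIter D m hm d h` is `h^{(d₀,…,d_{m-1})}`: the result of applying the shift
rotations `R^{d₀}_{0,1}, …, R^{d_{m-1}}_{m-1,m}` successively to `h`. -/
def hIter {σ : Signature} {A : Alg σ} {n k : ℕ} (D : DayOps A n) :
    (m : ℕ) → m < k → (Fin m → Fin (n+1)) → ((Fin k → Bool) → A.carrier) →
    ((Fin k → Bool) → A.carrier)
  | 0, _, _, h => h
  | (m+1), hm, d, h =>
      shiftRot D (d (Fin.last m)) ⟨m, by omega⟩ ⟨m+1, hm⟩
        (hIter D m (by omega) (fun i => d i.castSucc) h)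

/-- `X(T)`: the set of `(k-1)`-pivot lines of the matrices `h^d`, over all `T`-matrices
`h` and all `d ∈ {0,…,n}^{k-1}`. -/
def XSet {σ : Signature} {A : Alg σ} {n k : ℕ} (hk : 0 < k) (D : DayOps A n)
    (θ : Fin k → Congruence A) : A.carrier → A.carrier → Prop :=
  fun x y => ∃ h : (Fin k → Bool) → A.carrier, IsMatrix θ h ∧
    ∃ d : Fin (k-1) → Fin (n+1),
      x = hIter D (k-1) (by omega) d h
            (Function.update (fun _ => true) (⟨k-1, by omega⟩ : Fin k) false) ∧
      y = hIter D (k-1) (by omega) d h (fun _ => true)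

/-- Product algebra `A^I` with pointwise operations. -/
def prodAlg {σ : Signature} (A : Alg σ) (I : Type) : Alg σ where
  carrier := I → A.carrier
  nonempty := ⟨fun _ => Classical.choice A.nonempty⟩
  interp o x := fun i => A.interp o (fun mm => x mm i)

/-- Membership in the subalgebra of `B` generated by a set `S`. -/
inductive Gen {σ : Signature} (B : Alg σ) (S : Set B.carrier) : B.carrier → Prop
  | base : ∀ x ∈ S, Gen B S x
  | app : ∀ (o : σ.ops) (x : Fin (σ.arity o) → B.carrier),
      (∀ i, Gen B S (x i)) → Gen B S (B.interp o x)

/-- `f : A → B` is a homomorphism. -/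
def IsHom {σ : Signature} (A B : Alg σ) (f : A.carrier → B.carrier) : Prop :=
  ∀ (o : σ.ops) (x : Fin (σ.arity o) → A.carrier),
    f (A.interp o x) = B.interp o (fun i => f (x i))

/-- The kernel congruence of a homomorphism. -/
def kerCong {σ : Signature} {A B : Alg σ} (f : A.carrier → B.carrier)
    (hf : IsHom A B f) : Congruence A where
  rel x y := f x = f y
  iseqv := ⟨fun _ => rfl, Eq.symm, Eq.trans⟩
  compat o x y h := by
    show f (A.interp o x) = f (A.interp o y)
    rw [hf o x, hf o y]
    congr 1
    funext i
    exact h i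

/-- The image `f(γ)` of a congruence `γ ≥ ker f` under a surjective homomorphism `f`. -/
def mapCong {σ : Signature} {A B : Alg σ} (f : A.carrier → B.carrier)
    (hf : IsHom A B f) (hs : Function.Surjective f) (γ : Congruence A)
    (hγ : ∀ x y, f x = f y → γ.rel x y) : Congruence B where
  rel u v := ∃ x y, γ.rel x y ∧ f x = u ∧ f y = v
  iseqv := by
    refine ⟨?_, ?_, ?_⟩
    · intro u
      obtain ⟨x, hx⟩ := hs u
      exact ⟨x, x, γ.iseqv.refl x, hx, hx⟩
    · rintro u v ⟨x, y, hxy, hx, hy⟩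
      exact ⟨y, x, γ.iseqv.symm hxy, hy, hx⟩
    · rintro u v w ⟨x, y, hxy, hx, hy⟩ ⟨y', z, hyz, hy', hz⟩
      exact ⟨x, z, γ.iseqv.trans hxy (γ.iseqv.trans (hγ y y' (hy.trans hy'.symm)) hyz),
        hx, hz⟩
  compat o u v h := by
    choose x y hxy hx hy using h
    refine ⟨A.interp o x, A.interp o y, γ.compat o x y hxy, ?_, ?_⟩
    · rw [hf o x]
      congr 1
      funext i
      exact hx i
    · rw [hf o y]
      congr 1
      funext i
      exact hy i

/-- The preimage `f⁻¹(β)` of a congruence of `B` under a homomorphism `f`. -/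
def comapCong {σ : Signature} {A B : Alg σ} (f : A.carrier → B.carrier)
    (hf : IsHom A B f) (β : Congruence B) : Congruence A where
  rel x y := β.rel (f x) (f y)
  iseqv := ⟨fun _ => β.iseqv.refl _, β.iseqv.symm, β.iseqv.trans⟩
  compat o x y h := by
    show β.rel (f (A.interp o x)) (f (A.interp o y))
    rw [hf o x, hf o y]
    exact β.compat o _ _ h

/-- Substitute polynomials for the variables of a polynomial. -/
def Poly.bind {σ : Signature} {A : Alg σ} {V W : Type} (s : V → Poly A W) :
    Poly A V → Poly A W
  | .var v => s v
  | .const c => .const c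
  | .app o args => .app o (fun i => (args i).bind s)

theorem Poly.eval_bind {σ : Signature} {A : Alg σ} {V W : Type} (s : V → Poly A W)
    (p : Poly A V) (env : W → A.carrier) :
    (p.bind s).eval env = p.eval (fun v => (s v).eval env) := by
  induction p with
  | var v => rfl
  | const c => rfl
  | app o args ih => simp only [Poly.bind, Poly.eval, ih]

/-- Substitute polynomials for the variables of a term. -/
def Term.bindPoly {σ : Signature} {A : Alg σ} {V W : Type} (s : V → Poly A W) :
    Term σ V → Poly A W
  | .var v => s v
  | .app o args => .app o (fun i => (args i).bindPoly s)

theorem Term.eval_bindPoly {σ : Signature} {A : Alg σ} {V W : Type} (s : V → Poly A W)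
    (t : Term σ V) (env : W → A.carrier) :
    (t.bindPoly s).eval env = t.evalA A (fun v => (s v).eval env) := by
  induction t with
  | var v => rfl
  | app o args ih => simp only [Term.bindPoly, Poly.eval, Term.evalA, ih]

theorem Congruence.rel_evalA {σ : Signature} {A : Alg σ} (δ : Congruence A) {V : Type}
    (t : Term σ V) (x y : V → A.carrier) (h : ∀ v, δ.rel (x v) (y v)) :
    δ.rel (t.evalA A x) (t.evalA A y) := by
  induction t with
  | var v => exact h v
  | app o args ih => exact δ.compat o _ _ ih

theorem Congruence.rel_day {σ : Signature} {A : Alg σ} {n : ℕ} (δ : Congruence A)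
    (D : DayOps A n) (e : Fin (n + 1)) {x x' y y' z z' u u' : A.carrier}
    (hx : δ.rel x x') (hy : δ.rel y y') (hz : δ.rel z z') (hu : δ.rel u u') :
    δ.rel (D.m e x y z u) (D.m e x' y' z' u') := by
  obtain ⟨t, ht⟩ := D.isTerm e
  rw [ht, ht]
  refine δ.rel_evalA t _ _ fun v => ?_
  fin_cases v <;> assumption

/-- The Day operations detect membership of a pair in a congruence. -/
theorem DayOps.rel_of_forall {σ : Signature} {A : Alg σ} {n : ℕ} (D : DayOps A n)
    (δ : Congruence A) {r s u v : A.carrier} (hru : δ.rel r u)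
    (h : ∀ e, δ.rel (D.m e s r u v) (D.m e s s v v)) : δ.rel s v := by
  have key : ∀ e (he : e ≤ n), δ.rel s (D.m ⟨e, by omega⟩ s s v v) := by
    intro e
    induction e with
    | zero =>
      intro _
      have h0 := D.first s s v v
      change δ.rel s (D.m 0 s s v v)
      rw [h0]
      exact δ.iseqv.refl s
    | succ e ih =>
      intro he
      have ih := ih (by omega)
      rcases Nat.even_or_odd e with hev | hodd
      · rwa [D.even e (by omega) hev] at ih
      · have hodd := D.odd e (by omega) hodd s r v
        have h1 : ∀ e', δ.rel (D.m e' s r u v) (D.m e' s r r v) := fun e' =>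
          δ.rel_day D e' (δ.iseqv.refl s) (δ.iseqv.refl r) (δ.iseqv.symm hru)
            (δ.iseqv.refl v)
        have h2 := δ.iseqv.trans (δ.iseqv.trans ih (δ.iseqv.symm (h _))) (h1 _)
        rw [hodd] at h2
        exact δ.iseqv.trans h2 (δ.iseqv.trans (δ.iseqv.symm (h1 _)) (h _))
  have hn := key n le_rfl
  change δ.rel s (D.m (Fin.last n) s s v v) at hn
  rwa [D.last] at hn

/-- The shift rotation of a cube of functions, written as a single Day operation applied
to faces of the cube. -/
def rotateCube {σ : Signature} {A : Alg σ} {n : ℕ} {ι Z : Type} [DecidableEq ι] (D : DayOps A n)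
    (e : Fin (n + 1)) (j l : ι) (h : (ι → Bool) → Z → A.carrier) :
    (ι → Bool) → Z → A.carrier := fun g z =>
  D.m e (h (Function.update (Function.update g j false) l true) z)
    (h (Function.update g j false) z) (h g z) (h (Function.update g l true) z)

/-- Cubes induced by a polynomial evaluated in a family of environments. -/
def IsPolyCube {σ : Signature} {A : Alg σ} {ι Z X : Type}
    (env : (ι → Bool) → Z → X → A.carrier) (h : (ι → Bool) → Z → A.carrier) : Prop :=
  ∃ p : Poly A X, ∀ g z, h g z = p.eval (env g z)

/-- Restricting an environment to a face either leaves a variable unchanged or makes it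
constant. -/
def FaceClosed {σ : Signature} (A : Alg σ) {ι Z X : Type} [DecidableEq ι]
    (env : (ι → Bool) → Z → X → A.carrier) : Prop :=
  ∀ j b x, (∃ c, ∀ g z, env (Function.update g j b) z x = c) ∨
    ∀ g z, env (Function.update g j b) z x = env g z x

theorem IsPolyCube.face {σ : Signature} {A : Alg σ} {ι Z X : Type} [DecidableEq ι]
    {env : (ι → Bool) → Z → X → A.carrier} (hE : FaceClosed A env)
    {h : (ι → Bool) → Z → A.carrier} (hh : IsPolyCube env h) (j : ι) (b : Bool) :
    IsPolyCube env (fun g z => h (Function.update g j b) z) := by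
  obtain ⟨p, hp⟩ := hh
  have hs : ∀ x, ∃ q : Poly A X, ∀ g z,
      q.eval (env g z) = env (Function.update g j b) z x := by
    intro x
    rcases hE j b x with ⟨c, hc⟩ | hc
    · exact ⟨.const c, fun g z => (hc g z).symm⟩
    · exact ⟨.var x, fun g z => (hc g z).symm⟩
  choose s hs using hs
  refine ⟨p.bind s, fun g z => ?_⟩
  simp only [Poly.eval_bind, hp, hs]

theorem IsPolyCube.day {σ : Signature} {A : Alg σ} {n : ℕ} {ι Z X : Type}
    {env : (ι → Bool) → Z → X → A.carrier} (D : DayOps A n) (e : Fin (n + 1))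
    {h₀ h₁ h₂ h₃ : (ι → Bool) → Z → A.carrier} (hh₀ : IsPolyCube env h₀)
    (hh₁ : IsPolyCube env h₁) (hh₂ : IsPolyCube env h₂) (hh₃ : IsPolyCube env h₃) :
    IsPolyCube env (fun g z => D.m e (h₀ g z) (h₁ g z) (h₂ g z) (h₃ g z)) := by
  obtain ⟨p₀, hp₀⟩ := hh₀
  obtain ⟨p₁, hp₁⟩ := hh₁
  obtain ⟨p₂, hp₂⟩ := hh₂
  obtain ⟨p₃, hp₃⟩ := hh₃
  obtain ⟨t, ht⟩ := D.isTerm e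
  refine ⟨t.bindPoly ![p₀, p₁, p₂, p₃], fun g z => ?_⟩
  simp only [Term.eval_bindPoly, ht, hp₀, hp₁, hp₂, hp₃]
  congr 1
  funext v
  fin_cases v <;> rfl

theorem IsPolyCube.rotate {σ : Signature} {A : Alg σ} {n : ℕ} {ι Z X : Type} [DecidableEq ι]
    {env : (ι → Bool) → Z → X → A.carrier} (hE : FaceClosed A env) (D : DayOps A n)
    (e : Fin (n + 1)) (j l : ι) {h : (ι → Bool) → Z → A.carrier} (hh : IsPolyCube env h) :
    IsPolyCube env (rotateCube D e j l h) :=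
  .day D e ((hh.face hE l true).face hE j false) (hh.face hE j false) hh (hh.face hE l true)

/-- The lines of `h` in direction `j` satisfy: they are constant at vertices that vanish on
some element of `V`, they are `δ`-pairs over `W`, and over `d` the supporting ones are
`δ`-pairs. -/
structure Supported {σ : Signature} {A : Alg σ} {ι Z : Type} [DecidableEq ι]
    (δ : Congruence A) (W : Set Z) (d : Z) (j : ι) (V : Finset ι)
    (h : (ι → Bool) → Z → A.carrier) : Prop where
  const : ∀ g i z, i ∈ V → g i = false →
    h (Function.update g j false) z = h (Function.update g j true) z
  base : ∀ g, ∀ w ∈ W, δ.rel (h (Function.update g j false) w) (h (Function.update g j true) w)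
  supp : ∀ g i, i ≠ j → g i = false →
    δ.rel (h (Function.update g j false) d) (h (Function.update g j true) d)

section Rotation

variable {σ : Signature} {A : Alg σ} {n : ℕ} {ι Z : Type} [DecidableEq ι] (D : DayOps A n)
  (e : Fin (n + 1)) {j l : ι} (h : (ι → Bool) → Z → A.carrier)

theorem rotate_update_false (hjl : j ≠ l) (g : ι → Bool) (z : Z) (hg : g j = true) :
    rotateCube D e j l h (Function.update g l false) z =
      D.m e (h (Function.update (Function.update g l true) j false) z)
        (h (Function.update (Function.update g l false) j false) z)
        (h (Function.update (Function.update g l false) j true) z)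
        (h (Function.update (Function.update g l true) j true) z) := by
  have h1 : ∀ b, Function.update (Function.update g l b) j true = Function.update g l b := by
    intro b
    rw [Function.update_eq_self_iff, Function.update_of_ne hjl, hg]
  rw [h1, h1, rotateCube]
  simp [Function.update_comm hjl]

theorem rotate_update_true (hjl : j ≠ l) (g : ι → Bool) (z : Z) (hg : g j = true) :
    rotateCube D e j l h (Function.update g l true) z =
      D.m e (h (Function.update (Function.update g l true) j false) z)
        (h (Function.update (Function.update g l true) j false) z)
        (h (Function.update (Function.update g l true) j true) z)
        (h (Function.update (Function.update g l true) j true) z) := by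
  have h1 : Function.update (Function.update g l true) j true = Function.update g l true := by
    rw [Function.update_eq_self_iff, Function.update_of_ne hjl, hg]
  rw [h1, rotateCube]
  simp [Function.update_comm hjl]

theorem rotate_update_of_false (hjl : j ≠ l) (g : ι → Bool) (z : Z) (hg : g j = false)
    (b : Bool) :
    rotateCube D e j l h (Function.update g l b) z = h (Function.update g l true) z := by
  have h1 : Function.update (Function.update g l b) j false = Function.update g l b := by
    rw [Function.update_eq_self_iff, Function.update_of_ne hjl, hg]
  rw [rotateCube, h1, Function.update_idem, D.idem]

variable {h}

theorem Supported.rotate {δ : Congruence A} {W : Set Z} {d : Z} {V : Finset ι}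
    (hS : Supported δ W d j V h) (hjl : j ≠ l) (hl : l ∉ V) :
    Supported δ W d l (insert j V) (rotateCube D e j l h) := by
  have hrel : ∀ {r s u v : A.carrier}, δ.rel r u → δ.rel s v →
      δ.rel (D.m e s r u v) (D.m e s s v v) := by
    intro r s u v hru hsv
    have h1 : δ.rel (D.m e s r u v) s := by
      have := δ.rel_day D e (δ.iseqv.refl s) (δ.iseqv.refl r) (δ.iseqv.symm hru)
        (δ.iseqv.symm hsv)
      rwa [D.idem] at this
    have h2 : δ.rel (D.m e s s v v) s := by
      have := δ.rel_day D e (δ.iseqv.refl s) (δ.iseqv.refl s) (δ.iseqv.symm hsv)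
        (δ.iseqv.symm hsv)
      rwa [D.idem] at this
    exact δ.iseqv.trans h1 (δ.iseqv.symm h2)
  refine ⟨fun g i z hi hgi => ?_, fun g w hw => ?_, fun g i hi hgi => ?_⟩
  · cases hg : g j with
    | false => rw [rotate_update_of_false D e h hjl g z hg, rotate_update_of_false D e h hjl g z hg]
    | true =>
      have hiV : i ∈ V := by
        rcases Finset.mem_insert.1 hi with rfl | hi
        · simp [hg] at hgi
        · exact hi
      have hil : i ≠ l := fun hil => hl (hil ▸ hiV)
      have hc : ∀ b, h (Function.update (Function.update g l b) j false) z =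
          h (Function.update (Function.update g l b) j true) z := fun b =>
        hS.const _ i z hiV (by rw [Function.update_of_ne hil, hgi])
      rw [rotate_update_false D e h hjl g z hg, rotate_update_true D e h hjl g z hg, hc, hc,
        D.idem, D.idem]
  · cases hg : g j with
    | false =>
      rw [rotate_update_of_false D e h hjl g w hg, rotate_update_of_false D e h hjl g w hg]
      exact δ.iseqv.refl _
    | true =>
      rw [rotate_update_false D e h hjl g w hg, rotate_update_true D e h hjl g w hg]
      exact hrel (hS.base _ w hw) (hS.base _ w hw)
  · cases hg : g j with
    | false =>
      rw [rotate_update_of_false D e h hjl g d hg, rotate_update_of_false D e h hjl g d hg]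
      exact δ.iseqv.refl _
    | true =>
      have hij : i ≠ j := by
        rintro rfl
        simp [hg] at hgi
      rw [rotate_update_false D e h hjl g d hg, rotate_update_true D e h hjl g d hg]
      exact hrel (hS.supp _ i hij (by rw [Function.update_of_ne hi, hgi]))
        (hS.supp _ i hij (by rw [Function.update_of_ne hi, hgi]))

theorem Supported.pivot_of_rotate {δ : Congruence A} {W : Set Z} {d : Z} {V : Finset ι}
    (hS : Supported δ W d j V h) (hjl : j ≠ l)
    (hp : ∀ e, δ.rel (rotateCube D e j l h (Function.update (fun _ => true) l false) d)
      (rotateCube D e j l h (Function.update (fun _ => true) l true) d)) :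
    δ.rel (h (Function.update (fun _ => true) j false) d)
      (h (Function.update (fun _ => true) j true) d) := by
  have ht : Function.update (fun _ : ι => true) l true = fun _ => true :=
    Function.update_eq_self l _
  refine D.rel_of_forall δ
    (hS.supp (Function.update (fun _ => true) l false) l hjl.symm (by simp)) fun e => ?_
  have := hp e
  rwa [rotate_update_false D e h hjl _ d rfl, rotate_update_true D e h hjl _ d rfl, ht] at this

end Rotation

/-- Rotating along a path through all coordinates that ends in `t` reduces the pivot line in
direction `j` to pivot lines in direction `t` whose supporting lines are constant. -/
theorem Supported.pivot {σ : Signature} {A : Alg σ} {n : ℕ} {ι Z : Type} [DecidableEq ι]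
    [Fintype ι] (D : DayOps A n) {δ : Congruence A} {W : Set Z} {d : Z}
    (M : ((ι → Bool) → Z → A.carrier) → Prop)
    (hM : ∀ e j l h, M h → M (rotateCube D e j l h)) (t : ι)
    (hbase : ∀ h, M h → Supported δ W d t {t}ᶜ h →
      δ.rel (h (Function.update (fun _ => true) t false) d)
        (h (Function.update (fun _ => true) t true) d))
    {V : Finset ι} {j : ι} {h : (ι → Bool) → Z → A.carrier} (hMh : M h)
    (hS : Supported δ W d j V h) (hj : j ∉ V) (ht : t ∉ V) (hjt : j = t → V = {t}ᶜ) :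
    δ.rel (h (Function.update (fun _ => true) j false) d)
      (h (Function.update (fun _ => true) j true) d) := by
  induction hN : Vᶜ.card using Nat.strong_induction_on generalizing V j h with
  | _ N ih =>
    by_cases hjt' : j = t
    · obtain rfl := hjt'
      exact hbase h hMh (hjt rfl ▸ hS)
    have hlt : (insert j V)ᶜ.card < N := by
      rw [← hN]
      refine Finset.card_lt_card (Finset.ssubset_iff_subset_ne.2 ⟨?_, fun heq => ?_⟩)
      · exact Finset.compl_subset_compl.2 (Finset.subset_insert j V)
      · have : j ∈ (insert j V)ᶜ := heq ▸ Finset.mem_compl.2 hj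
        simp at this
    have ht' : t ∉ insert j V := by simp [ht, Ne.symm hjt']
    by_cases hex : ∃ l, l ∉ insert j V ∧ l ≠ t
    · obtain ⟨l, hl, hlt'⟩ := hex
      have hl' : j ≠ l ∧ l ∉ V := by
        simp only [Finset.mem_insert, not_or] at hl
        exact ⟨Ne.symm hl.1, hl.2⟩
      exact hS.pivot_of_rotate D hl'.1 fun e =>
        ih _ hlt (hM e j l h hMh) (hS.rotate D e hl'.1 hl'.2) hl ht' (fun hh => absurd hh hlt') rfl
    · push Not at hex
      have hV : insert j V = {t}ᶜ := by
        ext x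
        simp only [Finset.mem_compl, Finset.mem_singleton]
        exact ⟨fun hx hxt => ht' (hxt ▸ hx), fun hx => by_contra fun hx' => hx (hex x hx')⟩
      exact hS.pivot_of_rotate D hjt' fun e =>
        ih _ hlt (hM e j t h hMh) (hS.rotate D e hjt' ht) ht' ht' (fun _ => hV) rfl

/-- The term condition at one coordinate passes to every other coordinate and to every larger
congruence. -/
theorem TC.of_ne {σ : Signature} {A : Alg σ} {n k : ℕ} (D : DayOps A n)
    {α : Fin k → Congruence A} {t j : Fin k} (hjt : j ≠ t) {δ₀ δ : Congruence A}
    (hδ : δ₀ ≤ δ) (hT : TC α t δ₀) : TC α j δ := by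
  intro ν p a b hab hsupp
  let env : (Fin k → Bool) → Unit → (Σ i, Fin (ν i)) → A.carrier :=
    fun g _ x => if g x.1 then b x.1 x.2 else a x.1 x.2
  have hE : FaceClosed A env := by
    intro j c x
    by_cases hx : x.1 = j
    · subst hx
      exact .inl ⟨if c then b x.1 x.2 else a x.1 x.2, fun g z => by simp [env]⟩
    · exact .inr fun g z => by simp [env, hx]
  have key := Supported.pivot (δ := δ) (W := (∅ : Set Unit)) (d := ()) D (IsPolyCube env)
    (fun e j l h hh => hh.rotate hE D e j l) t ?_ (V := ∅) (j := j)
    (h := fun g _ => evalTup p a b g) ⟨p, fun _ _ => rfl⟩ ?_ (by simp) (by simp)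
    (fun hh => absurd hh hjt)
  · simpa using key
  · rintro h ⟨q, hq⟩ hS
    have hq' : ∀ g, h g () = evalTup q a b g := fun g => hq g ()
    rw [hq', hq', Function.update_eq_self t (fun _ => true)]
    refine hδ _ _ (hT ν q a b hab fun g hg ⟨i, hi, hgi⟩ => ?_)
    have := hS.const g i () (by simpa using hi) hgi
    rw [hq', hq', ← hg, Function.update_eq_self] at this
    rw [this]
    exact δ₀.iseqv.refl _
  · refine ⟨by simp, by simp, fun g i hi hgi => ?_⟩
    have := hsupp (Function.update g j false) (by simp)
      ⟨i, hi, by rw [Function.update_of_ne hi, hgi]⟩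
    simpa using this

/-- A property of tuples preserved by single-entry `R`-steps is preserved by entrywise
chains of `R`-steps. -/
theorem tuple_reflTransGen {X B : Type} [Finite X] [DecidableEq X] {R : B → B → Prop}
    (S : (X → B) → Prop) (hS : ∀ z x y, R (z x) y → S z → S (Function.update z x y))
    {z z' : X → B} (h : ∀ x, Relation.ReflTransGen R (z x) (z' x)) (hz : S z) : S z' := by
  have := Fintype.ofFinite X
  have hone : ∀ (w : X → B) x y, Relation.ReflTransGen R (w x) y → S w →
      S (Function.update w x y) := by
    intro w x y hy hw
    induction hy with
    | refl => simpa using hw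
    | tail _ hbc ih => simpa using hS _ x _ (by simpa using hbc) ih
  have key : ∀ s : Finset X, S (fun x => if x ∈ s then z' x else z x) := by
    intro s
    induction s using Finset.induction_on with
    | empty => simpa using hz
    | insert x s hx ih =>
      convert hone _ x (z' x) (by simpa [hx] using h x) ih using 1
      funext y
      by_cases hy : y = x
      · subst hy; simp
      · simp [hy]
  simpa using key Finset.univ

/-- Pairs in a join of congruences are connected by chains of pairs in the members. -/
theorem reflTransGen_of_supCong {σ : Signature} {A : Alg σ} {ι : Sort*}
    (γ : ι → Congruence A) {x y : A.carrier} (h : (supCong γ).rel x y) :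
    Relation.ReflTransGen (fun x y => ∃ i, (γ i).rel x y) x y := by
  have hsymm : Std.Symm (fun x y => ∃ i, (γ i).rel x y) :=
    ⟨fun _ _ ⟨i, hi⟩ => ⟨i, (γ i).iseqv.symm hi⟩⟩
  refine h ⟨⟨Relation.ReflTransGen (fun x y => ∃ i, (γ i).rel x y),
    ⟨fun _ => .refl, fun h => ?_, .trans⟩, fun o x y hxy => ?_⟩, fun x y hxy => .single hxy⟩
  · exact Std.Symm.symm _ _ h
  · refine tuple_reflTransGen (fun z => Relation.ReflTransGen (fun x y => ∃ i, (γ i).rel x y)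
      (A.interp o x) (A.interp o z)) (fun z k y ⟨i, hi⟩ hz => hz.tail ⟨i, ?_⟩) hxy .refl
    refine (γ i).compat o _ _ fun k' => ?_
    by_cases hk : k' = k
    · subst hk; simpa using hi
    · simpa [hk] using (γ i).iseqv.refl _

/-- The term condition at the first coordinate for a join in the last coordinate follows from
the term conditions for its members. -/
theorem TC.snoc_supCong {σ : Signature} {A : Alg σ} {n m : ℕ} (D : DayOps A n) (hm : 1 ≤ m)
    (θ : Fin m → Congruence A) {I : Type} (γ : I → Congruence A) {δ : Congruence A}
    (hT : ∀ i, ∀ t : Fin m, TC (Fin.snoc θ (γ i)) t.castSucc δ) :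
    TC (Fin.snoc θ (supCong γ)) (Fin.castSucc ⟨0, hm⟩) δ := by
  intro ν p a b hab hsupp
  let X := Σ i : Fin (m + 1), Fin (ν i)
  let env : (Fin m → Bool) → (X → A.carrier) → X → A.carrier := fun g z x =>
    if hx : x.1.val < m then if g ⟨x.1, hx⟩ then b x.1 x.2 else a x.1 x.2 else z x
  let c₀ : X → A.carrier := fun x => a x.1 x.2
  let d : X → A.carrier := fun x => if x.1.val < m then a x.1 x.2 else b x.1 x.2
  have hE : FaceClosed A env := by
    intro j c x
    by_cases hx : x.1.val < m
    · by_cases hxj : (⟨x.1, hx⟩ : Fin m) = j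
      · exact .inl ⟨if c then b x.1 x.2 else a x.1 x.2, fun g z => by simp [env, hx, hxj]⟩
      · exact .inr fun g z => by simp [env, hx, hxj]
    · exact .inr fun g z => by simp [env, hx]
  have hc₀ : ∀ g : Fin m → Bool, p.eval (env g c₀) = evalTup p a b (Fin.snoc g false) := by
    intro g
    rw [evalTup]
    congr 1
    funext ⟨i, y⟩
    refine Fin.lastCases (fun y => ?_) (fun i y => ?_) i y <;> simp [env, c₀]
  have hd : ∀ g : Fin m → Bool, p.eval (env g d) = evalTup p a b (Fin.snoc g true) := by
    intro g
    rw [evalTup]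
    congr 1
    funext ⟨i, y⟩
    refine Fin.lastCases (fun y => ?_) (fun i y => ?_) i y <;> simp [env, d]
  have hline : ∀ (g : Fin m → Bool) (c : Bool) (i : Fin (m + 1)),
      i ≠ Fin.castSucc ⟨0, hm⟩ → Fin.snoc (α := fun _ => Bool) g c i = false →
      δ.rel (evalTup p a b (Fin.snoc (Function.update g ⟨0, hm⟩ false) c))
        (evalTup p a b (Fin.snoc (Function.update g ⟨0, hm⟩ true) c)) := by
    intro g c i hi hgi
    have := hsupp (Function.update (Fin.snoc g c) (Fin.castSucc ⟨0, hm⟩) false) (by simp)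
      ⟨i, hi, by rw [Function.update_of_ne hi, hgi]⟩
    simpa only [Function.update_idem, Fin.snoc_update] using this
  have key := Supported.pivot (δ := δ) (W := {c₀}) (d := d) D (IsPolyCube env)
    (fun e j l h hh => hh.rotate hE D e j l) ⟨m - 1, by omega⟩ ?_ (V := ∅) (j := ⟨0, hm⟩)
    (h := fun g z => p.eval (env g z)) ⟨p, fun _ _ => rfl⟩ ?_ (by simp) (by simp) ?_
  · have ht : Fin.snoc (α := fun _ => Bool) (fun _ : Fin m => true) true = fun _ => true := by
      funext i
      refine Fin.lastCases ?_ (fun i => ?_) i <;> simp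
    simpa only [hd, Fin.snoc_update, ht, Function.update_eq_self] using key
  · generalize (⟨m - 1, by omega⟩ : Fin m) = t
    rintro h ⟨q, hq⟩ hS
    have hstep : ∀ (z : X → A.carrier) x y, (∃ i, (γ i).rel (z x) y) →
        δ.rel (h (Function.update (fun _ => true) t false) z)
          (h (Function.update (fun _ => true) t true) z) →
        δ.rel (h (Function.update (fun _ => true) t false) (Function.update z x y))
          (h (Function.update (fun _ => true) t true) (Function.update z x y)) := by
      rintro z x y ⟨i, hi⟩ hz
      let a' : ∀ i, Fin (ν i) → A.carrier := fun i k => if i.val < m then a i k else z ⟨i, k⟩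
      let b' : ∀ i, Fin (ν i) → A.carrier := fun i k =>
        if i.val < m then b i k else Function.update z x y ⟨i, k⟩
      have hev : ∀ g : Fin (m + 1) → Bool, evalTup q a' b' g =
          h (fun i => g i.castSucc) (if g (Fin.last m) then Function.update z x y else z) := by
        intro g
        rw [hq, evalTup]
        congr 1
        funext ⟨i, k⟩
        refine Fin.lastCases (fun k => ?_) (fun i k => ?_) i k
        · cases g (Fin.last m) <;> simp [env, a', b']
        · simp [env, a', b']
      have hup : ∀ (g : Fin (m + 1) → Bool) c,
          (fun i : Fin m => Function.update g t.castSucc c i.castSucc) =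
            Function.update (fun i => g i.castSucc) t c := fun g c =>
        Function.update_comp_eq_of_injective g (Fin.castSucc_injective m) t c
      have hab' : ∀ j k,
          (Fin.snoc (α := fun _ => Congruence A) θ (γ i) j).rel (a' j k) (b' j k) := by
        intro j k
        revert k
        refine Fin.lastCases (fun k => ?_) (fun j k => ?_) j
        · simp only [Fin.snoc_last, a', b', Fin.val_last, lt_irrefl, if_false]
          by_cases hk : (⟨Fin.last m, k⟩ : X) = x
          · subst hk
            simpa using hi
          · rw [Function.update_of_ne hk]
            exact (γ i).iseqv.refl _
        · simpa [a', b'] using hab j.castSucc k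
      have := hT i t ν q a' b' hab' fun g hg ⟨j, hj, hgj⟩ => by
        have hlast := (Fin.castSucc_lt_last t).ne'
        rw [hev, hev, hup, Function.update_of_ne hlast]
        have hg' : (fun i : Fin m => g i.castSucc) =
            Function.update (fun i => g i.castSucc) t false := by
          rw [eq_comm, Function.update_eq_self_iff, hg]
        rw [hg', Function.update_idem]
        by_cases hex : ∃ j : Fin m, j ≠ t ∧ g j.castSucc = false
        · obtain ⟨j, hj, hgj⟩ := hex
          rw [hS.const (fun i => g i.castSucc) j _ (by simpa using hj) hgj]
          exact δ.iseqv.refl _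
        · push Not at hex
          have hall : ∀ c, Function.update (fun i : Fin m => g i.castSucc) t c =
              Function.update (fun _ => true) t c := by
            intro c
            funext j
            by_cases hjt : j = t
            · subst hjt; simp
            · simpa [hjt] using hex j hjt
          have hgl : g (Fin.last m) = false := by
            induction j using Fin.lastCases with
            | last => exact hgj
            | cast j => exact absurd hgj (hex j fun hjt => hj (hjt ▸ rfl))
          rw [hall, hall, hgl]
          exact hz
      rw [hev, hev, hup, Function.update_of_ne (Fin.castSucc_lt_last t).ne'] at this
      rw [Function.update_eq_self t (fun _ => true)]
      exact this
    refine tuple_reflTransGen (R := fun x y => ∃ i, (γ i).rel x y)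
      (fun z => δ.rel (h (Function.update (fun _ => true) t false) z)
        (h (Function.update (fun _ => true) t true) z)) hstep (z := c₀) (z' := d) ?_
      (hS.base _ _ rfl)
    rintro ⟨i, y⟩
    refine Fin.lastCases (fun y => ?_) (fun i y => ?_) i y
    · have := hab (Fin.last m) y
      rw [Fin.snoc_last] at this
      simpa [c₀, d] using reflTransGen_of_supCong γ this
    · simpa [c₀, d] using Relation.ReflTransGen.refl
  · refine ⟨by simp, ?_, fun g i hi hgi => ?_⟩
    · rintro g w rfl
      rw [hc₀, hc₀]
      exact hline g false (Fin.last m) (Fin.castSucc_lt_last _).ne' (by simp)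
    · rw [hd, hd]
      exact hline g true i.castSucc (fun hh => hi (Fin.castSucc_injective m hh))
        (by simpa using hgi)
  · intro h0
    symm
    rw [Finset.compl_eq_empty_iff, Finset.eq_univ_iff_forall]
    simp only [Fin.ext_iff, Finset.mem_singleton] at h0 ⊢
    intro x
    omega

theorem TC.mono {σ : Signature} {A : Alg σ} {k : ℕ} {α β : Fin k → Congruence A} {j : Fin k}
    {δ : Congruence A} (hαβ : ∀ i, α i ≤ β i) (h : TC β j δ) : TC α j δ :=
  fun ν p a b hab => h ν p a b fun i mm => hαβ i _ _ (hab i mm)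

theorem TC.infCong {σ : Signature} {A : Alg σ} {k : ℕ} {α : Fin k → Congruence A} {j : Fin k}
    {ι : Sort*} {δ : ι → Congruence A} (h : ∀ i, TC α j (δ i)) :
    TC α j (UACommutator.infCong δ) :=
  fun ν p a b hab hs i => h i ν p a b hab fun g hg hex => hs g hg hex i

theorem TC.commTC {σ : Signature} {A : Alg σ} {k : ℕ} (α : Fin k → Congruence A) (j : Fin k) :
    TC α j (UACommutator.commTC α j) :=
  TC.infCong fun d => d.2

theorem Congruence.ext_rel {σ : Signature} {A : Alg σ} {a b : Congruence A}
    (hab : a ≤ b) (hba : b ≤ a) : a = b := by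
  obtain ⟨r, _, _⟩ := a
  obtain ⟨s, _, _⟩ := b
  have : r = s := by
    funext x y
    exact propext ⟨hab x y, hba x y⟩
  subst this
  rfl

theorem commutator_additive {σ : Signature} (A : Alg σ) (nn : ℕ) (D : DayOps A nn)
    (m : ℕ) (hm : 1 ≤ m) (θ : Fin m → Congruence A)
    {I : Type} [Nonempty I] (γ : I → Congruence A) :
    commTC (Fin.snoc θ (supCong γ)) (Fin.last m) =
      supCong (fun i => commTC (Fin.snoc θ (γ i)) (Fin.last m)) := by
  set δ := supCong (fun i => commTC (Fin.snoc θ (γ i)) (Fin.last m)) with hδ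
  have hle : ∀ i, commTC (Fin.snoc θ (γ i)) (Fin.last m) ≤ δ :=
    fun i x y hxy => Cg_base _ ⟨i, hxy⟩
  refine Congruence.ext_rel ?_ ?_
  · have hfirst : TC (Fin.snoc θ (supCong γ)) (Fin.castSucc ⟨0, hm⟩) δ :=
      TC.snoc_supCong D hm θ γ fun i t =>
        (TC.commTC _ _).of_ne D (Fin.castSucc_lt_last t).ne (hle i)
    exact fun x y hxy =>
      hxy ⟨δ, hfirst.of_ne D (Fin.castSucc_lt_last _).ne' fun _ _ => id⟩
  · intro x y hxy
    refine hxy ⟨_, ?_⟩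
    rintro x y ⟨i, hi⟩ ⟨δ', hδ'⟩
    refine hi ⟨δ', TC.mono (fun k => ?_) hδ'⟩
    refine Fin.lastCases ?_ (fun k => ?_) k
    · simp only [Fin.snoc_last]
      exact fun x y hxy => Cg_base _ ⟨i, hxy⟩
    · simp only [Fin.snoc_castSucc]
      exact fun _ _ => id

end UACommutator
end

section
/- Let A be an algebra with Day operations m₀,…,m_n and let α, β, δ ∈ Con(A). Then the term condition C(α, β; δ) holds if and only if the two term condition C_tt(α, β; δ) holds. -/
namespace UACommutator

/-- The binary two term condition `C_tt(α, β; δ)`. -/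
def Ctt2 {σ : Signature} {A : Alg σ} (α β δ : Congruence A) : Prop :=
  ∀ (ν μ : Fin 2 → ℕ) (t : Poly A (Σ i, Fin (ν i))) (s : Poly A (Σ i, Fin (μ i)))
    (a b : ∀ i, Fin (ν i) → A.carrier) (c d : ∀ i, Fin (μ i) → A.carrier),
    (∀ jj, α.rel (a 0 jj) (b 0 jj)) → (∀ jj, β.rel (a 1 jj) (b 1 jj)) →
    (∀ jj, α.rel (c 0 jj) (d 0 jj)) → (∀ jj, β.rel (c 1 jj) (d 1 jj)) →
    δ.rel (evalTup s c d ![false, false]) (evalTup t a b ![false, false]) →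
    δ.rel (evalTup s c d ![false, true]) (evalTup t a b ![false, true]) →
    δ.rel (evalTup s c d ![true, false]) (evalTup t a b ![true, false]) →
    δ.rel (evalTup s c d ![true, true]) (evalTup t a b ![true, true])

/-- Substitution of polynomials for the variables of a polynomial. -/
def Poly.subst {σ : Signature} {A : Alg σ} {V W : Type} (f : V → Poly A W) :
    Poly A V → Poly A W
  | .var v => f v
  | .const c => .const c
  | .app o args => .app o (fun i => (args i).subst f)

theorem Poly.eval_subst {σ : Signature} {A : Alg σ} {V W : Type} (f : V → Poly A W)
    (p : Poly A V) (env : W → A.carrier) :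
    (p.subst f).eval env = p.eval (fun v => (f v).eval env) := by
  induction p with
  | var v => rfl
  | const c => rfl
  | app o args ih => simp only [Poly.subst, Poly.eval, ih]

/-- Substitution of polynomials for the variables of a term. -/
def Term.toPoly {σ : Signature} {A : Alg σ} {V W : Type} (f : V → Poly A W) :
    Term σ V → Poly A W
  | .var v => f v
  | .app o args => .app o (fun i => (args i).toPoly f)

theorem Term.eval_toPoly {σ : Signature} {A : Alg σ} {V W : Type} (f : V → Poly A W)
    (t : Term σ V) (env : W → A.carrier) :
    (t.toPoly f).eval env = t.evalA A (fun v => (f v).eval env) := by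
  induction t with
  | var v => rfl
  | app o args ih => simp only [Term.toPoly, Poly.eval, Term.evalA, ih]

theorem Term.evalA_rel {σ : Signature} {A : Alg σ} {V : Type} (δ : Congruence A)
    (t : Term σ V) {x y : V → A.carrier} (h : ∀ v, δ.rel (x v) (y v)) :
    δ.rel (t.evalA A x) (t.evalA A y) := by
  induction t with
  | var v => exact h v
  | app o args ih => exact δ.compat o _ _ ih

namespace DayOps

variable {σ : Signature} {A : Alg σ} {n : ℕ} (D : DayOps A n)

theorem rel_m (δ : Congruence A) (e : Fin (n + 1)) {x y z u x' y' z' u' : A.carrier}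
    (hx : δ.rel x x') (hy : δ.rel y y') (hz : δ.rel z z') (hu : δ.rel u u') :
    δ.rel (D.m e x y z u) (D.m e x' y' z' u') := by
  obtain ⟨t, ht⟩ := D.isTerm e
  rw [ht, ht]
  refine t.evalA_rel δ fun v => ?_
  fin_cases v <;> assumption

theorem exists_poly {W : Type} (e : Fin (n + 1)) (p q r s : Poly A W) :
    ∃ f : Poly A W, ∀ env,
      f.eval env = D.m e (p.eval env) (q.eval env) (r.eval env) (s.eval env) := by
  obtain ⟨t, ht⟩ := D.isTerm e
  refine ⟨t.toPoly ![p, q, r, s], fun env => ?_⟩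
  rw [ht, Term.eval_toPoly]
  congr 1
  funext v
  fin_cases v <;> rfl

/-- Day's criterion for two elements to be congruent. -/
theorem rel_of_forall_rel (δ : Congruence A) {a b c d : A.carrier} (hbd : δ.rel b d)
    (h : ∀ e, δ.rel (D.m e a a c c) (D.m e a b d c)) : δ.rel a c := by
  have hb (e : Fin (n + 1)) : δ.rel (D.m e a a c c) (D.m e a b b c) :=
    δ.iseqv.trans (h e) (D.rel_m δ e (δ.iseqv.refl _) (δ.iseqv.refl _)
      (δ.iseqv.symm hbd) (δ.iseqv.refl _))
  have key : ∀ (e : ℕ) (he : e < n + 1), δ.rel a (D.m ⟨e, he⟩ a a c c) := by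
    intro e
    induction e with
    | zero =>
      intro he
      have h0 := D.first a a c c
      exact h0.symm ▸ δ.iseqv.refl a
    | succ e ih =>
      intro he
      have hprev := ih (by omega)
      rcases Nat.even_or_odd e with hev | hodd
      · rw [← D.even e (by omega) hev]
        exact hprev
      · refine δ.iseqv.trans hprev (δ.iseqv.trans (hb _) ?_)
        rw [D.odd e (by omega) hodd]
        exact δ.iseqv.symm (hb _)
  simpa [Fin.last] using (D.last a a c c) ▸ key n (by omega)

end DayOps

theorem TC_binary_iff {σ : Signature} {A : Alg σ} (α β δ : Congruence A) :
    TC ![α, β] (1 : Fin 2) δ ↔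
      ∀ (ν : Fin 2 → ℕ) (p : Poly A (Σ i, Fin (ν i))) (a b : ∀ i, Fin (ν i) → A.carrier),
        (∀ jj, α.rel (a 0 jj) (b 0 jj)) → (∀ jj, β.rel (a 1 jj) (b 1 jj)) →
        δ.rel (evalTup p a b ![false, false]) (evalTup p a b ![false, true]) →
        δ.rel (evalTup p a b ![true, false]) (evalTup p a b ![true, true]) := by
  have e1 : Function.update (fun _ : Fin 2 => true) 1 false = ![true, false] := by decide
  have e2 : (fun _ : Fin 2 => true) = ![true, true] := by decide
  have e3 : Function.update ![false, false] (1 : Fin 2) true = ![false, true] := by decide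
  constructor
  · intro h ν p a b h0 h1 hr
    have := h ν p a b (by intro i; fin_cases i; exacts [h0, h1]) ?_
    · rwa [e1, e2] at this
    · rintro g hg ⟨i, hi, hgi⟩
      have hg' : g = ![false, false] := by
        funext k
        fin_cases k
        · fin_cases i
          · exact hgi
          · exact absurd rfl hi
        · exact hg
      rw [hg', e3]
      exact hr
  · intro h ν p a b hab hr
    rw [e1, e2]
    refine h ν p a b (hab 0) (hab 1) ?_
    have := hr ![false, false] rfl ⟨0, by decide, rfl⟩
    rwa [e3] at this

/-- Freezing the second tuple of variables at the constants `k`, and renaming the first. -/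
theorem exists_poly_freeze {σ : Signature} {A : Alg σ} {ν μ : Fin 2 → ℕ}
    (p : Poly A (Σ i, Fin (ν i))) (f : Fin (ν 0) → Fin (μ 0)) (k : Fin (ν 1) → A.carrier) :
    ∃ q : Poly A (Σ i, Fin (μ i)), ∀ env,
      q.eval env = p.eval (fun x => match x with
        | ⟨0, j⟩ => env ⟨0, f j⟩
        | ⟨1, j⟩ => k j) := by
  refine ⟨p.subst (fun x => match x with
        | ⟨0, j⟩ => .var ⟨0, f j⟩
        | ⟨1, j⟩ => .const (k j)), fun env => ?_⟩
  rw [Poly.eval_subst]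
  congr 1
  funext x
  obtain ⟨i, j⟩ := x
  fin_cases i <;> rfl

theorem TC_of_Ctt2 {σ : Signature} {A : Alg σ} {α β δ : Congruence A}
    (h : Ctt2 α β δ) : TC ![α, β] (1 : Fin 2) δ := by
  rw [TC_binary_iff]
  intro ν p a b h0 h1 hr
  obtain ⟨q, hq⟩ := exists_poly_freeze (μ := ν) p id (a 1)
  have key (u v : Bool) : evalTup q a b ![u, v] = evalTup p a b ![u, false] := by
    simp only [evalTup, hq]
    congr 1
    funext ⟨i, j⟩
    fin_cases i <;> cases u <;> simp
  have := h ν ν p q a b a b h0 h1 h0 h1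
  simp only [key] at this
  exact this (δ.iseqv.refl _) hr (δ.iseqv.refl _)

theorem Ctt2_of_TC {σ : Signature} {A : Alg σ} {n : ℕ} (D : DayOps A n)
    {α β δ : Congruence A} (h : TC ![α, β] (1 : Fin 2) δ) : Ctt2 α β δ := by
  rw [TC_binary_iff] at h
  intro ν μ t s a b c d ha0 ha1 hc0 hc1 h00 h01 h10
  refine D.rel_of_forall_rel δ h10 fun e => ?_
  let κ : Fin 2 → ℕ := fun i => μ i + ν i
  let x : ∀ i, Fin (κ i) → A.carrier := fun i => Fin.append (c i) (a i)
  let y : ∀ i, Fin (κ i) → A.carrier := fun i => Fin.append (d i) (b i)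
  let s' : Poly A (Σ i, Fin (κ i)) := s.subst (fun z => .var ⟨z.1, Fin.castAdd _ z.2⟩)
  let t' : Poly A (Σ i, Fin (κ i)) := t.subst (fun z => .var ⟨z.1, Fin.natAdd _ z.2⟩)
  have hs' (g) : evalTup s' x y g = evalTup s c d g := by
    simp [s', evalTup, Poly.eval_subst, Poly.eval, x, y]
  have ht' (g) : evalTup t' x y g = evalTup t a b g := by
    simp [t', evalTup, Poly.eval_subst, Poly.eval, x, y]
  obtain ⟨s₁, hs₁⟩ := exists_poly_freeze (μ := κ) s (Fin.castAdd _) (d 1)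
  obtain ⟨t₁, ht₁⟩ := exists_poly_freeze (μ := κ) t (Fin.natAdd _) (b 1)
  have hs₁' (u v : Bool) : evalTup s₁ x y ![u, v] = evalTup s c d ![u, true] := by
    simp only [evalTup, hs₁]
    congr 1
    funext ⟨i, j⟩
    fin_cases i <;> cases u <;> simp [x, y]
  have ht₁' (u v : Bool) : evalTup t₁ x y ![u, v] = evalTup t a b ![u, true] := by
    simp only [evalTup, ht₁]
    congr 1
    funext ⟨i, j⟩
    fin_cases i <;> cases u <;> simp [x, y]
  obtain ⟨p, hp⟩ := D.exists_poly e s₁ s' t' t₁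
  have hp' (u v : Bool) : evalTup p x y ![u, v] =
      D.m e (evalTup s c d ![u, true]) (evalTup s c d ![u, v])
        (evalTup t a b ![u, v]) (evalTup t a b ![u, true]) := by
    rw [← hs₁' u v, ← ht₁' u v, ← hs', ← ht']
    exact hp _
  have append_rel {γ : Congruence A} (i : Fin 2) (hc : ∀ j, γ.rel (c i j) (d i j))
      (ha : ∀ j, γ.rel (a i j) (b i j)) : ∀ j, γ.rel (x i j) (y i j) := by
    refine Fin.addCases (fun j => ?_) (fun j => ?_)
    · simpa [x, y] using hc j
    · simpa [x, y] using ha j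
  have row (v : Bool) (hv : δ.rel (evalTup s c d ![false, v]) (evalTup t a b ![false, v])) :
      δ.rel (evalTup p x y ![false, v]) (evalTup s c d ![false, true]) := by
    rw [hp']
    have := D.rel_m δ e (δ.iseqv.refl (evalTup s c d ![false, true]))
      (δ.iseqv.refl (evalTup s c d ![false, v])) (δ.iseqv.symm hv) (δ.iseqv.symm h01)
    rwa [D.idem] at this
  have main := h κ p x y (append_rel 0 hc0 ha0) (append_rel 1 hc1 ha1)
    (δ.iseqv.trans (row false h00) (δ.iseqv.symm (row true h01)))
  rw [hp', hp'] at main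
  exact δ.iseqv.symm main

theorem binary_tc_iff_two_term {σ : Signature} (A : Alg σ) (n : ℕ) (D : DayOps A n)
    (α β δ : Congruence A) :
    TC ![α, β] (1 : Fin 2) δ ↔ Ctt2 α β δ :=
  ⟨Ctt2_of_TC D, TC_of_Ctt2⟩

end UACommutator
end
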